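/- There exists a constant C > 0 such that for every integer n ≥ 2, every integer k with 4 ≤ k ≤ n, every real B ≥ 1, and every δ ∈ (0,1), there is a two-round randomized algorithm making at most C · √B · n · log((log k)/δ) subset queries in total which, for every B-balanced k-clustering of an n-point set U, outputs exactly that partition with probability at least 1 − δ. -/

import Mathlib

open scoped ENNReal

/-- `count(S)`: the number of clusters (under the cluster labeling `c`) intersecting
the query set `S`. -/
def clusterCount {U K : Type*} [DecidableEq K] (c : U → K) (S : Finset U) : ℕ :=
  (S.image c).card

/-- A `k`-clustering of `Fin n` (given by the labeling `c`) is `B`-balanced if every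
cluster has size between `n/(Bk)` and `Bn/k`. -/
def IsBalanced {n k : ℕ} (B : ℝ) (c : Fin n → Fin k) : Prop :=
  ∀ j : Fin k,
    (n : ℝ) / (B * k) ≤ ((Finset.univ.filter (fun x => c x = j)).card : ℝ) ∧
    ((Finset.univ.filter (fun x => c x = j)).card : ℝ) ≤ B * n / k

section CoinWeighing

/-- A matrix is detecting if it has no nonzero kernel vector with entries in `{-1, 0, 1}`. -/
def IsDetecting {ι κ : Type} [Fintype κ] (D : ι → κ → ℤ) : Prop :=
  ∀ w : κ → ℤ, (∀ s, |w s| ≤ 1) → (∀ r, ∑ s, D r s * w s = 0) → w = 0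

/-- The number of columns of the recursively built detecting matrix with `2 ^ j` rows. -/
def detectWidth : ℕ → ℕ
  | 0 => 1
  | j + 1 => 2 * detectWidth j + 2 ^ j

theorem two_mul_detectWidth (j : ℕ) : 2 * detectWidth j = 2 ^ j * (j + 2) := by
  induction j with
  | zero => rfl
  | succ j ih =>
    rw [detectWidth, mul_add, ih]
    ring

theorem detectWidth_pos (j : ℕ) : 0 < detectWidth j := by
  have h := two_mul_detectWidth j
  have : 0 < 2 ^ j * (j + 2) := by positivity
  omega

theorem IsDetecting.double {ι κ : Type} [Fintype ι] [DecidableEq ι] [Fintype κ]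
    {D : ι → κ → ℤ} (hD : IsDetecting D) :
    IsDetecting (Sum.elim
      (fun r => Sum.elim (Sum.elim (D r) (D r)) (fun r' => if r' = r then 1 else 0))
      (fun r => Sum.elim (Sum.elim (D r) (fun s => -D r s)) (fun _ : ι => 0))) := by
  intro w hw h
  have h1 : ∀ r, ∑ s, D r s * w (.inl (.inl s)) + ∑ s, D r s * w (.inl (.inr s))
      + w (.inr r) = 0 := fun r => by simpa using h (.inl r)
  have h2 : ∀ r, ∑ s, D r s * w (.inl (.inl s)) - ∑ s, D r s * w (.inl (.inr s)) = 0 :=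
    fun r => by simpa [sub_eq_add_neg] using h (.inr r)
  have hz : ∀ r, w (.inr r) = 0 := fun r => by
    have := abs_le.1 (hw (.inr r))
    have := h1 r
    have := h2 r
    omega
  have hx : (fun s => w (.inl (.inl s))) = 0 := hD _ (fun s => hw _) fun r => by
    have := h1 r
    have := h2 r
    have := hz r
    omega
  have hy : (fun s => w (.inl (.inr s))) = 0 := hD _ (fun s => hw _) fun r => by
    have := h1 r
    have := h2 r
    have := hz r
    omega
  funext s
  rcases s with (s | s) | s
  · exact congrFun hx s
  · exact congrFun hy s
  · exact hz s

theorem exists_isDetecting (j : ℕ) :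
    ∃ D : Fin (2 ^ j) → Fin (detectWidth j) → ℤ,
      (∀ r s, D r s = -1 ∨ D r s = 0 ∨ D r s = 1) ∧ IsDetecting D := by
  induction j with
  | zero =>
    refine ⟨fun _ _ => 1, by simp, fun w _ h => ?_⟩
    funext s
    have : ∑ s : Fin 1, 1 * w s = 0 := h 0
    have hs : s = (0 : Fin 1) := Subsingleton.elim (α := Fin 1) _ _
    subst hs
    rw [Fin.sum_univ_one, one_mul] at this
    exact this
  | succ j ih =>
    obtain ⟨D, hD, hdet⟩ := ih
    let e₁ : Fin (2 ^ (j + 1)) ≃ Fin (2 ^ j) ⊕ Fin (2 ^ j) :=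
      Fintype.equivOfCardEq (by simp [pow_succ, mul_two])
    let e₂ : Fin (detectWidth (j + 1)) ≃
        (Fin (detectWidth j) ⊕ Fin (detectWidth j)) ⊕ Fin (2 ^ j) :=
      Fintype.equivOfCardEq (by simp [detectWidth, two_mul])
    refine ⟨fun r s => Sum.elim
        (fun r => Sum.elim (Sum.elim (D r) (D r)) (fun r' => if r' = r then 1 else 0))
        (fun r => Sum.elim (Sum.elim (D r) (fun s => -D r s)) (fun _ => 0)) (e₁ r) (e₂ s),
      ?_, fun w hw h => ?_⟩
    · intro r s
      beta_reduce
      rcases e₁ r with r | r <;> rcases e₂ s with (s | s) | s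
      · exact hD r s
      · exact hD r s
      · by_cases hsr : s = r <;> simp [hsr]
      · exact hD r s
      · have := hD r s
        simp only [Sum.elim_inl, Sum.elim_inr]
        omega
      · simp
    · have := hdet.double (fun s => w (e₂.symm s)) (fun s => hw _) fun r => by
        have := h (e₁.symm r)
        rw [← e₂.symm.sum_comp] at this
        simpa using this
      funext s
      simpa using congrFun this (e₂ s)

theorem IsDetecting.eq_zero_of_injOn {ι κ α : Type} [Fintype κ] [DecidableEq κ]
    {D : ι → κ → ℤ} (hD : IsDetecting D) {A : Finset α} {φ : α → κ}
    (hφ : Set.InjOn φ A) {w : α → ℤ} (hw : ∀ x, |w x| ≤ 1)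
    (h : ∀ r, ∑ x ∈ A, D r (φ x) * w x = 0) : ∀ x ∈ A, w x = 0 := by
  have hfib : ∀ x ∈ A, ∑ y ∈ A with φ y = φ x, w y = w x := fun x hx => by
    refine Finset.sum_eq_single_of_mem x (by simp [hx]) fun y hy hyx => ?_
    rw [Finset.mem_filter] at hy
    exact absurd (hφ hy.1 hx hy.2) hyx
  have h0 := hD (fun s => ∑ y ∈ A with φ y = s, w y) (fun s => ?_) fun r => ?_
  · intro x hx
    rw [← hfib x hx]
    exact congrFun h0 (φ x)
  · by_cases hs : ∃ x ∈ A, φ x = s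
    · obtain ⟨x, hx, rfl⟩ := hs
      rw [hfib x hx]
      exact hw x
    · push Not at hs
      rw [Finset.filter_false_of_mem hs]
      simp
  · rw [← h r, ← Finset.sum_fiberwise A φ]
    refine Finset.sum_congr rfl fun s _ => ?_
    rw [Finset.mul_sum]
    refine Finset.sum_congr rfl fun x hx => ?_
    rw [(Finset.mem_filter.1 hx).2]

end CoinWeighing

section Counting

theorem clusterCount_of_injOn {U K : Type} [DecidableEq K] {c : U → K} {S : Finset U}
    (h : Set.InjOn c S) : clusterCount c S = S.card :=
  Finset.card_image_of_injOn h

variable {U K : Type} [DecidableEq U] [DecidableEq K] {c : U → K}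

theorem clusterCount_union {T A : Finset U} (h : Set.InjOn c A) :
    (clusterCount c (T ∪ A) : ℤ) =
      clusterCount c T + ∑ x ∈ A, if c x ∈ T.image c then 0 else 1 := by
  have hsd : A.image c \ T.image c = (A.filter (fun x => c x ∉ T.image c)).image c := by
    ext y
    simp only [Finset.mem_sdiff, Finset.mem_image, Finset.mem_filter]
    constructor
    · rintro ⟨⟨x, hx, rfl⟩, hy⟩
      exact ⟨x, ⟨hx, hy⟩, rfl⟩
    · rintro ⟨x, ⟨hx, hy⟩, rfl⟩
      exact ⟨⟨x, hx, rfl⟩, hy⟩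
  have hinj : Set.InjOn c (A.filter (fun x => c x ∉ T.image c)) :=
    h.mono (by exact_mod_cast Finset.filter_subset _ _)
  rw [clusterCount, clusterCount, Finset.image_union, ← Finset.union_sdiff_self_eq_union,
    Finset.card_union_of_disjoint Finset.disjoint_sdiff, hsd, Finset.card_image_of_injOn hinj,
    Finset.card_filter]
  push_cast
  congr 1
  refine Finset.sum_congr rfl fun x _ => ?_
  by_cases hx : c x ∈ T.image c <;> simp [hx]

theorem clusterCount_insert_eq_iff {T : Finset U} {x : U} :
    clusterCount c (insert x T) = clusterCount c T ↔ c x ∈ T.image c := by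
  have h := clusterCount_union (c := c) (T := T) (A := {x}) (by simp)
  rw [Finset.union_comm, ← Finset.insert_eq, Finset.sum_singleton] at h
  by_cases hx : c x ∈ T.image c
  · rw [if_pos hx] at h
    exact iff_of_true (by omega) hx
  · rw [if_neg hx] at h
    exact iff_of_false (by omega) hx

end Counting

section Firsts

variable {n k : ℕ} {c c' : Fin n → Fin k} {p : Equiv.Perm (Fin n)} {t : ℕ}

/-- The points preceding `x` in its block, when the points are ordered by `p` and the order is
cut into blocks of length `t`. -/
def blockBefore (p : Equiv.Perm (Fin n)) (t : ℕ) (x : Fin n) : Finset (Fin n) :=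
  {y | p y < p x ∧ (p y : ℕ) / t = p x / t}

/-- The points that are the first of their cluster in their block. -/
def firsts (c : Fin n → Fin k) (p : Equiv.Perm (Fin n)) (t : ℕ) : Finset (Fin n) :=
  {x | c x ∉ (blockBefore p t x).image c}

theorem firsts_congr
    (h₀ : ∀ x, clusterCount c (blockBefore p t x) = clusterCount c' (blockBefore p t x))
    (h₁ : ∀ x, clusterCount c (insert x (blockBefore p t x)) =
      clusterCount c' (insert x (blockBefore p t x))) :
    firsts c p t = firsts c' p t := by
  ext x
  simp only [firsts, Finset.mem_filter_univ]
  rw [← clusterCount_insert_eq_iff, ← clusterCount_insert_eq_iff, h₀, h₁]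

theorem eq_of_mem_firsts {x y : Fin n} (hx : x ∈ firsts c p t) (hy : y ∈ firsts c p t)
    (hxy : (p x : ℕ) / t = p y / t) (h : c x = c y) : x = y := by
  simp only [firsts, blockBefore, Finset.mem_filter_univ, Finset.mem_image, not_exists,
    not_and] at hx hy
  rcases lt_trichotomy (p x) (p y) with hlt | heq | hlt
  · exact absurd h (hy x ⟨hlt, hxy⟩)
  · exact p.injective heq
  · exact absurd h.symm (hx y ⟨hlt, hxy.symm⟩)

theorem injOn_firsts_one : Set.InjOn c (firsts c 1 n) := fun x hx y hy h =>
  eq_of_mem_firsts hx hy (by simp [Nat.div_eq_of_lt]) h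

theorem exists_mem_firsts_one (x : Fin n) : ∃ r ∈ firsts c 1 n, c r = c x := by
  obtain ⟨r, hr, hmin⟩ := Finset.exists_min_image ({y | c y = c x} : Finset (Fin n)) id
    ⟨x, by simp⟩
  rw [Finset.mem_filter_univ] at hr
  refine ⟨r, ?_, hr⟩
  simp only [firsts, blockBefore, Finset.mem_filter_univ, Finset.mem_image, not_exists, not_and]
  intro y hy hyr
  exact absurd (hmin y (by simp [hyr, hr])) (not_le.2 hy.1)

end Firsts

section Labels

variable {n k : ℕ} {c c' c₀ : Fin n → Fin k}

/-- The representatives of the clusters of `c₀` whose label has a one in position `b`. -/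
def bitReps (c₀ : Fin n → Fin k) (b : ℕ) : Finset (Fin n) :=
  {r ∈ firsts c₀ 1 n | (c₀ r : ℕ).testBit b = true}

theorem bitReps_subset (b : ℕ) : bitReps c₀ b ⊆ firsts c₀ 1 n := Finset.filter_subset _ _

theorem injOn_bitReps (hR : firsts c 1 n = firsts c₀ 1 n) (b : ℕ) :
    Set.InjOn c (bitReps c₀ b) := by
  have h := injOn_firsts_one (c := c)
  rw [hR] at h
  exact h.mono (by exact_mod_cast bitReps_subset b)

theorem mem_image_bitReps_iff (hR : firsts c 1 n = firsts c₀ 1 n) {r x : Fin n}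
    (hr : r ∈ firsts c₀ 1 n) (hrx : c r = c x) (b : ℕ) :
    c x ∈ (bitReps c₀ b).image c ↔ (c₀ r : ℕ).testBit b = true := by
  have hinj := injOn_firsts_one (c := c)
  rw [hR] at hinj
  simp only [Finset.mem_image, bitReps, Finset.mem_filter]
  constructor
  · rintro ⟨r', ⟨hr', hb⟩, h⟩
    rwa [hinj hr hr' (hrx.trans h.symm)]
  · exact fun hb => ⟨r, ⟨hr, hb⟩, hrx⟩

theorem ker_eq_of_bits {l : ℕ} (hl : k ≤ 2 ^ l) (hR : firsts c 1 n = firsts c₀ 1 n)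
    (hR' : firsts c' 1 n = firsts c₀ 1 n)
    (h : ∀ x, ∀ b < l, (c x ∈ (bitReps c₀ b).image c ↔ c' x ∈ (bitReps c₀ b).image c')) :
    Setoid.ker c = Setoid.ker c' := by
  have hrep : ∀ x, ∃ r ∈ firsts c₀ 1 n, c r = c x ∧ c' r = c' x := by
    intro x
    obtain ⟨r, hr, hrx⟩ := exists_mem_firsts_one (c := c) x
    obtain ⟨r', hr', hrx'⟩ := exists_mem_firsts_one (c := c') x
    rw [hR] at hr
    rw [hR'] at hr'
    have hbits : (c₀ r : ℕ) = c₀ r' := by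
      refine Nat.eq_of_testBit_eq fun b => ?_
      rcases lt_or_ge b l with hb | hb
      · have := h x b hb
        rw [mem_image_bitReps_iff hR hr hrx, mem_image_bitReps_iff hR' hr' hrx'] at this
        exact Bool.eq_iff_iff.2 this
      · have hlt : ∀ y : Fin n, (c₀ y : ℕ) < 2 ^ b := fun y =>
          (c₀ y).isLt.trans_le (hl.trans (Nat.pow_le_pow_right two_pos hb))
        rw [Nat.testBit_lt_two_pow (hlt r), Nat.testBit_lt_two_pow (hlt r')]
    obtain rfl : r = r' := injOn_firsts_one hr hr' (Fin.ext hbits)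
    exact ⟨r, hr, hrx, hrx'⟩
  have hinj := injOn_firsts_one (c := c)
  have hinj' := injOn_firsts_one (c := c')
  rw [hR] at hinj
  rw [hR'] at hinj'
  ext x y
  obtain ⟨r, hr, hx, hx'⟩ := hrep x
  obtain ⟨s, hs, hy, hy'⟩ := hrep y
  rw [Setoid.ker_def, Setoid.ker_def, ← hx, ← hy, ← hx', ← hy']
  exact (hinj.eq_iff hr hs).trans (hinj'.eq_iff hr hs).symm

theorem sum_indicator_eq_of_clusterCount_eq (hR : firsts c 1 n = firsts c₀ 1 n)
    (hR' : firsts c' 1 n = firsts c₀ 1 n) {b : ℕ} {A : Finset (Fin n)}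
    (hA : Set.InjOn c A) (hA' : Set.InjOn c' A)
    (h : clusterCount c (bitReps c₀ b ∪ A) = clusterCount c' (bitReps c₀ b ∪ A)) :
    ∑ x ∈ A, ((if c x ∈ (bitReps c₀ b).image c then 0 else 1 : ℤ) -
      if c' x ∈ (bitReps c₀ b).image c' then 0 else 1) = 0 := by
  have h1 := clusterCount_union (T := bitReps c₀ b) hA
  have h2 := clusterCount_union (T := bitReps c₀ b) hA'
  rw [clusterCount_of_injOn (injOn_bitReps hR b)] at h1
  rw [clusterCount_of_injOn (injOn_bitReps hR' b)] at h2
  rw [Finset.sum_sub_distrib]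
  have : (clusterCount c (bitReps c₀ b ∪ A) : ℤ) = clusterCount c' (bitReps c₀ b ∪ A) := by
    exact_mod_cast h
  linarith

/-- Weighing the bits of the labels of the points of one block, all of which are firsts. -/
theorem block_bits_eq {p : Equiv.Perm (Fin n)} {t : ℕ} (ht : 0 < t) {ι : Type}
    {D : ι → Fin t → ℤ} (hD : ∀ r s, D r s = -1 ∨ D r s = 0 ∨ D r s = 1) (hdet : IsDetecting D)
    (hR : firsts c 1 n = firsts c₀ 1 n) (hR' : firsts c' 1 n = firsts c₀ 1 n)
    {F : Finset (Fin n)} (hF : firsts c p t = F) (hF' : firsts c' p t = F) {b q : ℕ}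
    (h : ∀ r, ∀ ε : Bool,
      let S := bitReps c₀ b ∪ {x ∈ F | (p x : ℕ) / t = q ∧
        D r ⟨p x % t, Nat.mod_lt _ ht⟩ = if ε then 1 else -1}
      clusterCount c S = clusterCount c' S)
    {x : Fin n} (hx : x ∈ F) (hxq : (p x : ℕ) / t = q) :
    c x ∈ (bitReps c₀ b).image c ↔ c' x ∈ (bitReps c₀ b).image c' := by
  have hinj : ∀ P : Fin n → Prop, ∀ [DecidablePred P],
      Set.InjOn c ({x ∈ F | (p x : ℕ) / t = q ∧ P x} : Finset (Fin n)) ∧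
      Set.InjOn c' ({x ∈ F | (p x : ℕ) / t = q ∧ P x} : Finset (Fin n)) := by
    intro P _
    constructor <;> intro y hy z hz hyz <;>
      simp only [Finset.coe_filter, Set.mem_ofPred_eq] at hy hz
    · exact eq_of_mem_firsts (hF ▸ hy.1) (hF ▸ hz.1) (hy.2.1.trans hz.2.1.symm) hyz
    · exact eq_of_mem_firsts (hF' ▸ hy.1) (hF' ▸ hz.1) (hy.2.1.trans hz.2.1.symm) hyz
  have hw := hdet.eq_zero_of_injOn (A := {x ∈ F | (p x : ℕ) / t = q})
    (φ := fun x => ⟨p x % t, Nat.mod_lt _ ht⟩)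
    (w := fun x => (if c x ∈ (bitReps c₀ b).image c then 0 else 1 : ℤ) -
      if c' x ∈ (bitReps c₀ b).image c' then 0 else 1) ?_ ?_ ?_ x (by simp [hx, hxq])
  · split_ifs at hw with h1 h2 h2
    · exact iff_of_true h1 h2
    · norm_num at hw
    · norm_num at hw
    · exact iff_of_false h1 h2
  · intro y hy z hz hyz
    simp only [Finset.coe_filter, Set.mem_ofPred_eq] at hy hz
    refine p.injective (Fin.ext ?_)
    have hm : (p y : ℕ) % t = p z % t := congrArg Fin.val hyz
    rw [← Nat.div_add_mod (p y) t, ← Nat.div_add_mod (p z) t, hy.2, hz.2, hm]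
  · intro y
    split_ifs <;> simp
  · intro r
    have hpos := sum_indicator_eq_of_clusterCount_eq hR hR' (hinj _).1 (hinj _).2 (h r true)
    have hneg := sum_indicator_eq_of_clusterCount_eq hR hR' (hinj _).1 (hinj _).2 (h r false)
    rw [← Finset.filter_filter, Finset.sum_filter] at hpos hneg
    have hsub := congrArg₂ (fun a b : ℤ => a - b) hpos hneg
    simp only [sub_zero, ← Finset.sum_sub_distrib] at hsub
    refine Eq.trans (Finset.sum_congr rfl fun y _ => ?_) hsub
    rcases hD r ⟨p y % t, Nat.mod_lt _ ht⟩ with hd | hd | hd <;> simp [hd]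

end Labels

section SecondRound

variable {n k : ℕ}

/-- Index type of the second-round queries: signed detecting-matrix rows for every block and
every bit, and single-point queries for up to `z` points. -/
abbrev SecondIndex (n t l j z : ℕ) : Type :=
  (Fin (n / t + 1) × Fin l × Fin (2 ^ j) × Bool) ⊕ (Fin z × Fin l)

/-- First-round queries: initial segments of the natural order, and of every block for each of
the orders `ω i`. -/
def firstQueries {M : ℕ} (t : ℕ) (ω : Fin M → Equiv.Perm (Fin n)) :
    Option (Fin M) × Fin n × Bool → Finset (Fin n) := fun a =>
  let S := a.1.elim (blockBefore 1 n a.2.1) (fun i => blockBefore (ω i) t a.2.1)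
  if a.2.2 then insert a.2.1 S else S

theorem exists_second_round {M l j z : ℕ} (hl : k ≤ 2 ^ l)
    (ω : Fin M → Equiv.Perm (Fin n)) {c₀ : Fin n → Fin k}
    (hgood : ∃ i, (firsts c₀ (ω i) (detectWidth j))ᶜ.card ≤ z) :
    ∃ Q : SecondIndex n (detectWidth j) l j z → Finset (Fin n), ∀ c c' : Fin n → Fin k,
      (∀ a, clusterCount c (firstQueries (detectWidth j) ω a) =
        clusterCount c₀ (firstQueries (detectWidth j) ω a)) →
      (∀ a, clusterCount c' (firstQueries (detectWidth j) ω a) =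
        clusterCount c₀ (firstQueries (detectWidth j) ω a)) →
      (∀ a, clusterCount c (Q a) = clusterCount c' (Q a)) → Setoid.ker c = Setoid.ker c' := by
  classical
  obtain ⟨i, hi⟩ := hgood
  have ht := detectWidth_pos j
  have hD := exists_isDetecting j
  set t := detectWidth j
  obtain ⟨D, hD, hdet⟩ := hD
  set p := ω i
  set F := firsts c₀ p t
  obtain ⟨g⟩ : Nonempty ((Fᶜ : Finset (Fin n)) ↪ Fin z) :=
    Function.Embedding.nonempty_of_card_le (by rwa [Fintype.card_coe, Fintype.card_fin])
  refine ⟨Sum.elim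
    (fun a => bitReps c₀ a.2.1 ∪ {x ∈ F | (p x : ℕ) / t = a.1 ∧
        D a.2.2.1 ⟨p x % t, Nat.mod_lt _ ht⟩ = if a.2.2.2 then 1 else -1})
    (fun a => bitReps c₀ a.2 ∪ Finset.univ.filter fun x => ∃ h : x ∈ Fᶜ, g ⟨x, h⟩ = a.1), fun c c' hc hc' h => ?_⟩
  have hR : ∀ {d : Fin n → Fin k}, (∀ a, clusterCount d (firstQueries t ω a) =
      clusterCount c₀ (firstQueries t ω a)) → firsts d 1 n = firsts c₀ 1 n := fun hd =>
    firsts_congr (fun x => by simpa [firstQueries] using hd (none, x, false))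
      (fun x => by simpa [firstQueries] using hd (none, x, true))
  have hF : ∀ {d : Fin n → Fin k}, (∀ a, clusterCount d (firstQueries t ω a) =
      clusterCount c₀ (firstQueries t ω a)) → firsts d p t = F := fun hd =>
    firsts_congr (fun x => by simpa [firstQueries] using hd (some i, x, false))
      (fun x => by simpa [firstQueries] using hd (some i, x, true))
  refine ker_eq_of_bits hl (hR hc) (hR hc') fun x b hb => ?_
  by_cases hx : x ∈ F
  · have hq : (p x : ℕ) / t < n / t + 1 :=
      Nat.lt_succ_of_le (Nat.div_le_div_right (p x).isLt.le)
    exact block_bits_eq ht hD hdet (hR hc) (hR hc') (hF hc) (hF hc')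
      (fun r ε => h (.inl (⟨_, hq⟩, ⟨b, hb⟩, r, ε))) hx rfl
  · have hx' : x ∈ Fᶜ := Finset.mem_compl.2 hx
    have hset : ({y | ∃ h : y ∈ Fᶜ, g ⟨y, h⟩ = g ⟨x, hx'⟩} : Finset (Fin n)) = {x} := by
      ext y
      simp only [Finset.mem_filter_univ, Finset.mem_singleton, g.injective.eq_iff]
      exact ⟨fun ⟨_, h⟩ => congrArg Subtype.val h, fun h => by subst h; exact ⟨hx', rfl⟩⟩
    have hq := h (.inr (g ⟨x, hx'⟩, ⟨b, hb⟩))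
    simp only [Sum.elim_inr, hset] at hq
    have hw := sum_indicator_eq_of_clusterCount_eq (hR hc) (hR hc') (by simp) (by simp) hq
    rw [Finset.sum_singleton] at hw
    split_ifs at hw with h1 h2 h2
    · exact iff_of_true h1 h2
    · norm_num at hw
    · norm_num at hw
    · exact iff_of_false h1 h2

/-- If after the first round, from any labeling consistent with the answers, one can find
queries that determine the partition, then there are a second-round map and a decoder. -/
theorem exists_decoder {m₁ m₂ : ℕ} (Q₁ : Fin m₁ → Finset (Fin n)) (G : Set (Fin n → Fin k))
    (h : ∀ c₀ ∈ G, ∃ Q : Fin m₂ → Finset (Fin n), ∀ c c' : Fin n → Fin k,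
      (∀ a, clusterCount c (Q₁ a) = clusterCount c₀ (Q₁ a)) →
      (∀ a, clusterCount c' (Q₁ a) = clusterCount c₀ (Q₁ a)) →
      (∀ a, clusterCount c (Q a) = clusterCount c' (Q a)) → Setoid.ker c = Setoid.ker c') :
    ∃ (f : (Fin m₁ → ℕ) → Fin m₂ → Finset (Fin n))
      (dec : (Fin m₁ → ℕ) → (Fin m₂ → ℕ) → Setoid (Fin n)), ∀ c ∈ G,
        dec (fun i => clusterCount c (Q₁ i))
          (fun i => clusterCount c (f (fun i => clusterCount c (Q₁ i)) i)) = Setoid.ker c := by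
  classical
  have hf : ∀ a₁ : Fin m₁ → ℕ, ∃ Q : Fin m₂ → Finset (Fin n), ∀ c ∈ G, ∀ c' ∈ G,
      (fun i => clusterCount c (Q₁ i)) = a₁ → (fun i => clusterCount c' (Q₁ i)) = a₁ →
      (∀ a, clusterCount c (Q a) = clusterCount c' (Q a)) → Setoid.ker c = Setoid.ker c' := by
    intro a₁
    by_cases ha : ∃ c₀ ∈ G, (fun i => clusterCount c₀ (Q₁ i)) = a₁
    · obtain ⟨c₀, hc₀, rfl⟩ := ha
      obtain ⟨Q, hQ⟩ := h c₀ hc₀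
      exact ⟨Q, fun c _ c' _ hc hc' => hQ c c' (congrFun hc) (congrFun hc')⟩
    · exact ⟨fun _ => ∅, fun c hc _ _ hca => absurd ⟨c, hc, hca⟩ ha⟩
  choose f hf using hf
  have hdec : ∀ (a₁ : Fin m₁ → ℕ) (a₂ : Fin m₂ → ℕ), ∃ s : Setoid (Fin n), ∀ c ∈ G,
      (fun i => clusterCount c (Q₁ i)) = a₁ → (fun i => clusterCount c (f a₁ i)) = a₂ →
      s = Setoid.ker c := by
    intro a₁ a₂
    by_cases ha : ∃ c ∈ G, (fun i => clusterCount c (Q₁ i)) = a₁ ∧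
        (fun i => clusterCount c (f a₁ i)) = a₂
    · obtain ⟨c, hc, h₁, h₂⟩ := ha
      exact ⟨Setoid.ker c, fun c' hc' h₁' h₂' =>
        hf a₁ c hc c' hc' h₁ h₁' (congrFun (h₂.trans h₂'.symm))⟩
    · exact ⟨⊥, fun c hc h₁ h₂ => absurd ⟨c, hc, h₁, h₂⟩ ha⟩
  choose dec hdec using hdec
  exact ⟨f, dec, fun c hc => hdec _ _ c hc rfl rfl⟩

end SecondRound

section RandomOrder

variable {n k : ℕ}

theorem card_block_le (p : Equiv.Perm (Fin n)) {t : ℕ} (ht : 0 < t) (q : ℕ) :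
    ({y | q = (p y : ℕ) / t} : Finset (Fin n)).card ≤ t := by
  refine (Finset.card_le_card_of_injOn (t := Finset.range t) (fun y => (p y : ℕ) % t)
    (fun y _ => by simpa using Nat.mod_lt _ ht) fun y hy z hz hyz => ?_).trans
    (Finset.card_range t).le
  simp only [Finset.coe_filter, Finset.mem_univ, true_and, Set.mem_ofPred_eq] at hy hz
  refine p.injective (Fin.ext ?_)
  have hm : (p y : ℕ) % t = p z % t := hyz
  rw [← Nat.div_add_mod (p y) t, ← Nat.div_add_mod (p z) t, ← hy, ← hz, hm]

theorem mul_card_same_block_le {t : ℕ} (ht : 0 < t) {x y : Fin n} (hxy : y ≠ x) :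
    n * ({p : Equiv.Perm (Fin n) | (p x : ℕ) / t = p y / t} : Finset _).card ≤
      n.factorial * t := by
  have hle : ∀ z : Fin n, ({p : Equiv.Perm (Fin n) | (p x : ℕ) / t = p y / t} : Finset _).card ≤
      ({p : Equiv.Perm (Fin n) | (p x : ℕ) / t = p z / t} : Finset _).card := by
    intro z
    by_cases hz : z = x
    · subst hz
      exact Finset.card_le_card fun p _ => by simp
    · refine (Finset.card_equiv (Equiv.mulRight (Equiv.swap y z)) fun p => ?_).le
      simp [Equiv.swap_apply_of_ne_of_ne hxy.symm (Ne.symm hz)]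
  calc n * ({p : Equiv.Perm (Fin n) | (p x : ℕ) / t = p y / t} : Finset _).card
      = ∑ _z : Fin n, ({p : Equiv.Perm (Fin n) | (p x : ℕ) / t = p y / t} : Finset _).card := by
        simp
    _ ≤ ∑ z : Fin n, ({p : Equiv.Perm (Fin n) | (p x : ℕ) / t = p z / t} : Finset _).card :=
        Finset.sum_le_sum fun z _ => hle z
    _ = ∑ p : Equiv.Perm (Fin n), ({z | (p x : ℕ) / t = p z / t} : Finset (Fin n)).card := by
        simp only [Finset.card_filter]
        exact Finset.sum_comm
    _ ≤ ∑ _p : Equiv.Perm (Fin n), t := Finset.sum_le_sum fun p _ => card_block_le p ht _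
    _ = n.factorial * t := by simp [Fintype.card_perm]

theorem card_compl_firsts_le (c : Fin n → Fin k) (p : Equiv.Perm (Fin n)) (t : ℕ) :
    (firsts c p t)ᶜ.card ≤ ∑ x : Fin n, ∑ y with y ≠ x ∧ c y = c x,
      if (p x : ℕ) / t = p y / t then 1 else 0 := by
  rw [Finset.card_eq_sum_ones]
  refine (Finset.sum_le_sum fun x hx => ?_).trans
    (Finset.sum_le_univ_sum_of_nonneg fun x => Nat.zero_le _)
  simp only [firsts, blockBefore, Finset.mem_compl, Finset.mem_filter_univ, not_not,
    Finset.mem_image] at hx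
  obtain ⟨y, ⟨hlt, hblock⟩, hc⟩ := hx
  refine le_of_eq_of_le (if_pos hblock.symm).symm
    (Finset.single_le_sum (f := fun y => if (p x : ℕ) / t = p y / t then 1 else 0)
      (fun _ _ => Nat.zero_le _) ?_)
  rw [Finset.mem_filter_univ]
  exact ⟨fun h => hlt.ne (congrArg p h), hc⟩

theorem sum_card_compl_firsts_le (hn : 0 < n) (c : Fin n → Fin k) {t : ℕ} (ht : 0 < t) {s : ℝ}
    (hs : ∀ j, ((Finset.univ.filter (fun x => c x = j)).card : ℝ) ≤ s) :
    (∑ p : Equiv.Perm (Fin n), ((firsts c p t)ᶜ.card : ℝ)) ≤ s * n.factorial * t := by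
  have hnat : n * ∑ p : Equiv.Perm (Fin n), (firsts c p t)ᶜ.card ≤
      ∑ x : Fin n, (Finset.univ.filter (fun y => c y = c x)).card * (n.factorial * t) := by
    calc n * ∑ p : Equiv.Perm (Fin n), (firsts c p t)ᶜ.card
        ≤ n * ∑ p : Equiv.Perm (Fin n), ∑ x : Fin n, ∑ y with y ≠ x ∧ c y = c x,
            if (p x : ℕ) / t = p y / t then 1 else 0 := by
          gcongr
          exact card_compl_firsts_le c _ t
      _ = ∑ x : Fin n, ∑ y with y ≠ x ∧ c y = c x,
            n * ({p : Equiv.Perm (Fin n) | (p x : ℕ) / t = p y / t} : Finset _).card := by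
          rw [Finset.sum_comm, Finset.mul_sum]
          refine Finset.sum_congr rfl fun x _ => ?_
          rw [Finset.sum_comm, Finset.mul_sum]
          simp only [Finset.card_filter]
      _ ≤ ∑ x : Fin n, ∑ _y with _y ≠ x ∧ c _y = c x, n.factorial * t :=
          Finset.sum_le_sum fun x _ => Finset.sum_le_sum fun y hy =>
            mul_card_same_block_le ht ((Finset.mem_filter_univ y).1 hy).1
      _ ≤ ∑ x : Fin n, (Finset.univ.filter (fun y => c y = c x)).card * (n.factorial * t) := by
          refine Finset.sum_le_sum fun x _ => ?_
          rw [Finset.sum_const, smul_eq_mul]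
          exact Nat.mul_le_mul_right _ (Finset.card_le_card fun y hy => by simp_all)
  have hreal : (n : ℝ) * ∑ p : Equiv.Perm (Fin n), ((firsts c p t)ᶜ.card : ℝ) ≤
      n * (s * n.factorial * t) := by
    calc (n : ℝ) * ∑ p : Equiv.Perm (Fin n), ((firsts c p t)ᶜ.card : ℝ)
        ≤ ∑ x : Fin n, ((Finset.univ.filter (fun y => c y = c x)).card : ℝ) *
            (n.factorial * t) := by exact_mod_cast hnat
      _ ≤ ∑ _x : Fin n, s * (n.factorial * t) :=
          Finset.sum_le_sum fun x _ => mul_le_mul_of_nonneg_right (hs _) (by positivity)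
      _ = n * (s * n.factorial * t) := by
          rw [Finset.sum_const, Finset.card_univ, Fintype.card_fin, nsmul_eq_mul, mul_assoc s]
  exact le_of_mul_le_mul_left hreal (by exact_mod_cast hn)

theorem two_mul_card_bad_le (hn : 0 < n) (c : Fin n → Fin k) {t z : ℕ} (ht : 0 < t) {s : ℝ}
    (hs : ∀ j, ((Finset.univ.filter (fun x => c x = j)).card : ℝ) ≤ s)
    (hz : 2 * s * t ≤ z + 1) :
    2 * ({p : Equiv.Perm (Fin n) | ¬ (firsts c p t)ᶜ.card ≤ z} : Finset _).card ≤
      Fintype.card (Equiv.Perm (Fin n)) := by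
  set b := ({p : Equiv.Perm (Fin n) | ¬ (firsts c p t)ᶜ.card ≤ z} : Finset _)
  have h1 : (b.card : ℝ) * (z + 1) ≤ s * n.factorial * t := by
    refine le_trans ?_ (sum_card_compl_firsts_le hn c ht hs)
    rw [← nsmul_eq_mul]
    refine (Finset.card_nsmul_le_sum b _ _ fun p hp => ?_).trans
      (Finset.sum_le_univ_sum_of_nonneg fun p => Nat.cast_nonneg _)
    have := (Finset.mem_filter.1 hp).2
    exact_mod_cast not_le.1 this
  have h2 : (2 * (b.card : ℝ)) * (z + 1) ≤ n.factorial * (z + 1) := by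
    have : (n.factorial : ℝ) * (2 * s * t) ≤ n.factorial * (z + 1) := by gcongr
    linarith
  have h3 := le_of_mul_le_mul_right h2 (by positivity)
  rw [Fintype.card_perm, Fintype.card_fin]
  exact_mod_cast h3

theorem ofReal_le_uniform_exists {Ω : Type} [Fintype Ω] [Nonempty Ω] (P : Ω → Prop)
    [DecidablePred P] (h : 2 * ({a | ¬ P a} : Finset Ω).card ≤ Fintype.card Ω) {M : ℕ} {δ : ℝ}
    (hδ : (1 / 2 : ℝ) ^ M ≤ δ) :
    ENNReal.ofReal (1 - δ) ≤
      (PMF.uniformOfFintype (Fin M → Ω)).toOuterMeasure {ω | ∃ i, P (ω i)} := by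
  classical
  have hbad : ({a | ¬ P a} : Finset Ω).card ^ M + Fintype.card {ω : Fin M → Ω // ∃ i, P (ω i)} =
      Fintype.card (Fin M → Ω) := by
    rw [← Fintype.card_piFinset_const, Fintype.card_subtype, add_comm, ← Finset.card_univ,
      ← Finset.card_filter_add_card_filter_not (s := Finset.univ)
        (fun ω : Fin M → Ω => ∃ i, P (ω i))]
    congr 2
    ext ω
    simp [Fintype.mem_piFinset]
  have hN : (Fintype.card (Fin M → Ω) : ℝ) = (Fintype.card Ω : ℝ) ^ M := by simp
  have hle : ((({a | ¬ P a} : Finset Ω).card : ℝ)) ^ M ≤ δ * (Fintype.card Ω : ℝ) ^ M := by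
    have h' : 2 * (({a | ¬ P a} : Finset Ω).card : ℝ) ≤ Fintype.card Ω := by exact_mod_cast h
    calc ((({a | ¬ P a} : Finset Ω).card : ℝ)) ^ M ≤ (1 / 2 * Fintype.card Ω) ^ M := by
          gcongr
          linarith
      _ = (1 / 2) ^ M * (Fintype.card Ω : ℝ) ^ M := mul_pow _ _ _
      _ ≤ δ * (Fintype.card Ω : ℝ) ^ M := by gcongr
  have hbad' : ((({a | ¬ P a} : Finset Ω).card : ℝ)) ^ M +
      Fintype.card {ω : Fin M → Ω // ∃ i, P (ω i)} = (Fintype.card Ω : ℝ) ^ M := by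
    rw [← hN]
    exact_mod_cast hbad
  rw [PMF.toOuterMeasure_uniformOfFintype_apply,
    ENNReal.le_div_iff_mul_le (Or.inl (by simp)) (Or.inl (by simp)),
    ← ENNReal.ofReal_natCast (Fintype.card (Fin M → Ω)), hN,
    ← ENNReal.ofReal_mul' (by positivity), ← ENNReal.ofReal_natCast]
  refine ENNReal.ofReal_le_ofReal ?_
  have hgood : (1 - δ) * (Fintype.card Ω : ℝ) ^ M ≤
      Fintype.card {ω : Fin M → Ω // ∃ i, P (ω i)} := by linarith
  exact hgood

end RandomOrder

section Budget

theorem pow_four_le (l : ℕ) : l ^ 4 ≤ 32 * 2 ^ l := by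
  rcases le_or_gt l 6 with hl | hl
  · interval_cases l <;> norm_num
  · induction l, hl using Nat.le_induction with
    | base => norm_num
    | succ l hl ih =>
      have : (l + 1) ^ 4 ≤ 2 * l ^ 4 := by
        obtain ⟨m, rfl⟩ := Nat.exists_eq_add_of_le hl
        ring_nf
        nlinarith [sq_nonneg m, Nat.zero_le (m ^ 3)]
      rw [pow_succ 2 l]
      omega

theorem detectWidth_pow_four_le (l : ℕ) : detectWidth (l / 8) ^ 4 ≤ 2 ^ l := by
  have h1 : detectWidth (l / 8) ≤ 2 ^ (2 * (l / 8)) := by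
    have h := two_mul_detectWidth (l / 8)
    have h2 : l / 8 + 1 ≤ 2 ^ (l / 8) := Nat.lt_two_pow_self
    have h3 := Nat.mul_le_mul_left (2 ^ (l / 8)) h2
    rw [two_mul (l / 8), pow_add]
    nlinarith [Nat.zero_le (2 ^ (l / 8) * (l / 8))]
  calc detectWidth (l / 8) ^ 4 ≤ (2 ^ (2 * (l / 8))) ^ 4 := Nat.pow_le_pow_left h1 4
    _ = 2 ^ (8 * (l / 8)) := by rw [← pow_mul]; congr 1; ring
    _ ≤ 2 ^ l := Nat.pow_le_pow_right two_pos (Nat.mul_div_le l 8)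

theorem two_pow_clog_le {k : ℕ} (hk : 2 ≤ k) : 2 ^ Nat.clog 2 k ≤ 2 * k := by
  have h := Nat.pow_pred_clog_lt_self one_lt_two hk
  have h0 := Nat.clog_pos one_lt_two hk
  obtain ⟨m, hm⟩ := Nat.exists_eq_succ_of_ne_zero h0.ne'
  rw [hm] at h ⊢
  rw [pow_succ]
  simp only [Nat.pred_succ] at h
  omega

theorem block_budget {n k : ℕ} (hk : 2 ≤ k) (hkn : k ≤ n) :
    (n / detectWidth (Nat.clog 2 k / 8) + 1) * (Nat.clog 2 k * (2 ^ (Nat.clog 2 k / 8) * 2)) ≤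
      36 * n := by
  have hpow := two_pow_clog_le hk
  set l := Nat.clog 2 k
  have hw := two_mul_detectWidth (l / 8)
  set j := l / 8 with hj
  have h1 : l * 2 ^ j ≤ 2 * n := by
    have : l ≤ 2 ^ (l - j) := by
      rcases Nat.eq_zero_or_pos l with h0 | h0
      · exact h0.le.trans (Nat.zero_le _)
      · obtain ⟨m, hm⟩ : ∃ m, l - j = m + 1 := ⟨l - j - 1, by omega⟩
        have hlt : m < 2 ^ m := Nat.lt_two_pow_self
        rw [hm, pow_succ]
        omega
    calc l * 2 ^ j ≤ 2 ^ (l - j) * 2 ^ j := Nat.mul_le_mul_right _ this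
      _ = 2 ^ l := by rw [← pow_add]; congr 1; omega
      _ ≤ 2 * n := by omega
  have h2 : l * (2 ^ j * 2) ≤ 32 * detectWidth j := by
    have : l ≤ 8 * (j + 2) := by omega
    nlinarith [Nat.mul_le_mul_right (2 ^ j) this]
  have h3 : n / detectWidth j * detectWidth j ≤ n := Nat.div_mul_le_self _ _
  nlinarith [Nat.mul_le_mul_left (n / detectWidth j) h2]

/-- The number of points that may be queried individually. -/
noncomputable def extraPoints (n k t : ℕ) (B : ℝ) : ℕ :=
  if B ^ 2 ≤ k then ⌊2 * (B * n / k) * t⌋₊ else n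

theorem extra_budget {n k : ℕ} (hk : 2 ≤ k) {B : ℝ} (hB : 1 ≤ B) :
    (extraPoints n k (detectWidth (Nat.clog 2 k / 8)) B : ℝ) * Nat.clog 2 k ≤
      8 * Real.sqrt B * n := by
  have hpow : (2 : ℝ) ^ Nat.clog 2 k ≤ 2 * k := by exact_mod_cast two_pow_clog_le hk
  set l := Nat.clog 2 k
  have hl : (l : ℝ) ^ 4 ≤ 32 * 2 ^ l := by exact_mod_cast pow_four_le l
  have ht : (detectWidth (l / 8) : ℝ) ^ 4 ≤ 2 ^ l := by exact_mod_cast detectWidth_pow_four_le l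
  set t := detectWidth (l / 8)
  have hk0 : (0 : ℝ) < k := by exact_mod_cast (by omega : 0 < k)
  have hsB : 1 ≤ Real.sqrt B := Real.one_le_sqrt.2 hB
  have hsq : Real.sqrt B ^ 2 = B := Real.sq_sqrt (by linarith)
  unfold extraPoints
  split_ifs with hBk
  · have h4 : ((t : ℝ) * l * B) ^ 4 ≤ (4 * k) ^ 4 := by
      calc ((t : ℝ) * l * B) ^ 4 = t ^ 4 * l ^ 4 * (B ^ 2) ^ 2 := by ring
        _ ≤ (2 * (k : ℝ)) * (32 * (2 * k)) * k ^ 2 := by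
          gcongr
          · exact ht.trans hpow
          · exact hl.trans (by gcongr)
        _ ≤ (4 * k) ^ 4 := by nlinarith [pow_pos hk0 4]
    have h1 : (t : ℝ) * l * B ≤ 4 * k := le_of_pow_le_pow_left₀ (by norm_num) (by positivity) h4
    calc ((⌊2 * (B * n / k) * t⌋₊ : ℕ) : ℝ) * l ≤ 2 * (B * n / k) * t * l := by
          gcongr
          exact Nat.floor_le (by positivity)
      _ = 2 * n * (t * l * B) / k := by ring
      _ ≤ 2 * n * (4 * k) / k := by gcongr
      _ = 8 * 1 * n := by field_simp; ring
      _ ≤ 8 * Real.sqrt B * n := by gcongr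
  · have h4 : (l : ℝ) ^ 4 ≤ (8 * Real.sqrt B) ^ 4 := by
      calc (l : ℝ) ^ 4 ≤ 32 * (2 * k) := hl.trans (by gcongr)
        _ ≤ 4096 * B ^ 2 := by linarith [not_le.1 hBk]
        _ = (8 * Real.sqrt B) ^ 4 := by
          nth_rewrite 1 [← hsq]
          ring
    have h1 : (l : ℝ) ≤ 8 * Real.sqrt B := le_of_pow_le_pow_left₀ (by norm_num) (by positivity) h4
    rw [mul_comm]
    gcongr

end Budget

/-- There is a constant `C > 0` such that for all `n ≥ 2`, `4 ≤ k ≤ n`, `B ≥ 1`,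
`δ ∈ (0,1)`, there is a two-round randomized algorithm (a distribution over triples of
a first-round query sequence, a map from first-round answers to second-round queries,
and a decoder) making at most `C·√B·n·log₂((log₂ k)/δ)` subset queries in total, which
for every `B`-balanced `k`-clustering of an `n`-point set outputs exactly that
partition with probability at least `1 - δ`. -/
theorem two_round_balanced_clustering :
    ∃ C : ℝ, 0 < C ∧
      ∀ n k : ℕ, 2 ≤ n → 4 ≤ k → k ≤ n →
        ∀ B : ℝ, 1 ≤ B →
          ∀ δ : ℝ, 0 < δ → δ < 1 →
            ∃ m₁ m₂ : ℕ,
              ((m₁ : ℝ) + (m₂ : ℝ)) ≤ C * Real.sqrt B * n * Real.logb 2 (Real.logb 2 k / δ) ∧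
              ∃ D : PMF ((Fin m₁ → Finset (Fin n)) ×
                  ((Fin m₁ → ℕ) → Fin m₂ → Finset (Fin n)) ×
                  ((Fin m₁ → ℕ) → (Fin m₂ → ℕ) → Setoid (Fin n))),
                ∀ c : Fin n → Fin k, IsBalanced B c →
                  ENNReal.ofReal (1 - δ) ≤
                    D.toOuterMeasure
                      {a | a.2.2 (fun i => clusterCount c (a.1 i))
                          (fun j => clusterCount c
                            (a.2.1 (fun i => clusterCount c (a.1 i)) j)) = Setoid.ker c} := by
  classical
  refine ⟨100, by norm_num, fun n k hn hk hkn B hB δ hδ hδ1 => ?_⟩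
  have hk4 : (4 : ℝ) ≤ k := by exact_mod_cast hk
  set l := Nat.clog 2 k with hl
  set t := detectWidth (l / 8) with ht
  set z := extraPoints n k t B with hz
  set M := ⌈Real.logb 2 (1 / δ)⌉₊ with hM
  set L := Real.logb 2 (Real.logb 2 k / δ) with hL
  have hδM : (1 / 2 : ℝ) ^ M ≤ δ := by
    have h1 : 1 / δ ≤ (2 : ℝ) ^ (M : ℝ) := by
      rw [← Real.logb_le_iff_le_rpow (by norm_num) (by positivity)]
      exact Nat.le_ceil _
    rw [Real.rpow_natCast, div_le_iff₀ hδ] at h1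
    rw [div_pow, one_pow, div_le_iff₀ (by positivity), mul_comm]
    exact h1
  have hδ0 : 0 < Real.logb 2 (1 / δ) :=
    Real.logb_pos (by norm_num) ((one_lt_div hδ).2 hδ1)
  have hLM : (M : ℝ) ≤ L ∧ 1 ≤ L := by
    have hk2 : 2 ≤ Real.logb 2 k := by
      rw [Real.le_logb_iff_rpow_le (by norm_num) (by linarith)]
      norm_num [hk4]
    have h1 : 1 + Real.logb 2 (1 / δ) ≤ L := by
      calc 1 + Real.logb 2 (1 / δ) = Real.logb 2 (2 * (1 / δ)) := by
            rw [Real.logb_mul (by norm_num) (by positivity),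
              Real.logb_self_eq_one (by norm_num)]
        _ ≤ L := Real.logb_le_logb_of_le (by norm_num) (by positivity) (by
            rw [mul_one_div]
            gcongr)
    exact ⟨((Nat.ceil_lt_add_one hδ0.le).le.trans (by linarith)), by linarith⟩
  let e₁ := Fintype.equivFin (Option (Fin M) × Fin n × Bool)
  let e₂ := Fintype.equivFin (SecondIndex n t l (l / 8) z)
  refine ⟨Fintype.card (Option (Fin M) × Fin n × Bool),
    Fintype.card (SecondIndex n t l (l / 8) z), ?_, ?_⟩
  · have h1 : (((n / t + 1) * (l * (2 ^ (l / 8) * 2)) : ℕ) : ℝ) ≤ 36 * n := by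
      exact_mod_cast block_budget (by omega) hkn
    have h2 := extra_budget (n := n) (k := k) (by omega) hB
    have hsB : 1 ≤ Real.sqrt B := Real.one_le_sqrt.2 hB
    have hcard₁ : Fintype.card (Option (Fin M) × Fin n × Bool) = (M + 1) * (n * 2) := by simp
    have hcard₂ : Fintype.card (SecondIndex n t l (l / 8) z) =
        (n / t + 1) * (l * (2 ^ (l / 8) * 2)) + z * l := by simp [SecondIndex]
    rw [hcard₁, hcard₂, Nat.cast_add]
    rw [Nat.cast_mul, Nat.cast_mul z l]
    have hn0 : (0 : ℝ) ≤ n := Nat.cast_nonneg n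
    have h3 : (n : ℝ) ≤ n * L := le_mul_of_one_le_right hn0 hLM.2
    have h4 : (n : ℝ) * L ≤ Real.sqrt B * (n * L) :=
      le_mul_of_one_le_left (by linarith) hsB
    have h5 : Real.sqrt B * n ≤ Real.sqrt B * (n * L) := by gcongr
    have h6 : (n : ℝ) * M ≤ n * L := mul_le_mul_of_nonneg_left hLM.1 hn0
    push_cast at h1 ⊢
    linarith
  · have hdec := fun ω : Fin M → Equiv.Perm (Fin n) =>
      exists_decoder (fun a => firstQueries t ω (e₁.symm a))
        {c : Fin n → Fin k | ∃ i, (firsts c (ω i) t)ᶜ.card ≤ z} (fun c₀ hc₀ => by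
          obtain ⟨Q, hQ⟩ := exists_second_round (j := l / 8) (Nat.le_pow_clog one_lt_two k) ω hc₀
          refine ⟨fun a => Q (e₂.symm a), fun c c' h h' h₂ => hQ c c' ?_ ?_ ?_⟩
          · exact fun a => by simpa using h (e₁ a)
          · exact fun a => by simpa using h' (e₁ a)
          · exact fun a => by simpa using h₂ (e₂ a))
    choose f dec hdec using hdec
    refine ⟨(PMF.uniformOfFintype (Fin M → Equiv.Perm (Fin n))).map
      fun ω => (fun a => firstQueries t ω (e₁.symm a), f ω, dec ω), fun c hc => ?_⟩
    rw [PMF.toOuterMeasure_map_apply]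
    refine (ofReal_le_uniform_exists (fun p => (firsts c p t)ᶜ.card ≤ z) ?_ hδM).trans
      (MeasureTheory.measure_mono fun ω hω => hdec ω c hω)
    by_cases hBk : B ^ 2 ≤ k
    · refine two_mul_card_bad_le (by omega) c (detectWidth_pos _) (fun j => (hc j).2) ?_
      rw [hz, extraPoints, if_pos hBk]
      exact (Nat.lt_floor_add_one _).le
    · have hzn : z = n := if_neg hBk
      rw [Finset.filter_false_of_mem]
      · simp
      · intro p _
        rw [not_not, hzn]
        exact (Finset.card_le_univ _).trans (Fintype.card_fin n).le
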